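/- arXiv:2007.05701 — 2 statements merged into one kernel-verified Lean document; each statement's English description precedes it below -/
import Mathlib

section
/- Let h : [0,1] → [0,1] be the bijection defined by h(x) = 1/2 − x for 0 ≤ x ≤ 1/2 and h(x) = x for 1/2 < x ≤ 1 (note h ∘ h is the identity). Then for every function f : [0,1] → ℂ one has var(f ∘ h, [0,1]) ≤ 2 var(f, [0,1]), and consequently (1/2)‖f‖_{BV[0,1]} ≤ ‖f ∘ h‖_{BV[0,1]} ≤ 2‖f‖_{BV[0,1]}; in particular f ↦ f ∘ h is a Banach algebra isomorphism of BV[0,1] onto itself, even though h is not a homeomorphism. -/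
open scoped ENNReal
open Set

noncomputable section

/-- The classical `BV[0,1]` norm of a function `g : ℝ → ℂ` restricted to `[0,1]`:
`‖g‖_∞ + var(g, [0,1])`, valued in `ℝ≥0∞`. -/
def bvNormUnit (g : ℝ → ℂ) : ℝ≥0∞ :=
  (⨆ x : Icc (0 : ℝ) 1, (‖g x‖₊ : ℝ≥0∞)) + eVariationOn g (Icc 0 1)

/-- A map that is antitone up to `c`, monotone from `c` on, and sends `[a,b]` into `s` at most
doubles the variation. -/
theorem eVariationOn_comp_le_two_mul {E : Type*} [PseudoEMetricSpace E] (f : ℝ → E) {h : ℝ → ℝ}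
    {s : Set ℝ} {a b c : ℝ} (hac : a ≤ c) (hcb : c ≤ b) (hanti : AntitoneOn h (Icc a c))
    (hmono : MonotoneOn h (Icc c b)) (hmaps : MapsTo h (Icc a b) s) :
    eVariationOn (f ∘ h) (Icc a b) ≤ 2 * eVariationOn f s := by
  rw [← Icc_union_Icc_eq_Icc hac hcb,
    eVariationOn.union (f ∘ h) (isGreatest_Icc hac) (isLeast_Icc hcb), two_mul]
  exact add_le_add
    (eVariationOn.comp_le_of_antitoneOn f h hanti
      (hmaps.mono_left (Icc_subset_Icc_right hcb)))
    (eVariationOn.comp_le_of_monotoneOn f h hmono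
      (hmaps.mono_left (Icc_subset_Icc_left hac)))

theorem bvNormUnit_congr {f g : ℝ → ℂ} (hfg : EqOn f g (Icc 0 1)) :
    bvNormUnit f = bvNormUnit g := by
  unfold bvNormUnit
  rw [eVariationOn.eq_of_eqOn hfg]
  congr 1
  exact iSup_congr fun x => by rw [hfg x.2]

theorem bvNormUnit_comp_le {f : ℝ → ℂ} {h : ℝ → ℝ} (hmaps : MapsTo h (Icc 0 1) (Icc 0 1))
    (hvar : eVariationOn (f ∘ h) (Icc 0 1) ≤ 2 * eVariationOn f (Icc 0 1)) :
    bvNormUnit (f ∘ h) ≤ 2 * bvNormUnit f := by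
  unfold bvNormUnit
  rw [mul_add]
  refine add_le_add ?_ hvar
  calc (⨆ x : Icc (0 : ℝ) 1, (‖(f ∘ h) x‖₊ : ℝ≥0∞))
      ≤ ⨆ x : Icc (0 : ℝ) 1, (‖f x‖₊ : ℝ≥0∞) :=
        iSup_le fun x =>
          le_iSup (fun y : Icc (0 : ℝ) 1 => (‖f y‖₊ : ℝ≥0∞)) ⟨h x, hmaps x.2⟩
    _ ≤ 2 * ⨆ x : Icc (0 : ℝ) 1, (‖f x‖₊ : ℝ≥0∞) := le_mul_of_one_le_left' one_le_two

/-- Example 3.1 of the paper.  Let `h : [0,1] → [0,1]` be the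
bijection `h(x) = 1/2 − x` for `0 ≤ x ≤ 1/2` and `h(x) = x` for `1/2 < x ≤ 1`
(so `h ∘ h` is the identity on `[0,1]`).  Then for every `f : [0,1] → ℂ`,
`var(f ∘ h, [0,1]) ≤ 2 var(f, [0,1])`, and consequently
`(1/2) ‖f‖_{BV[0,1]} ≤ ‖f ∘ h‖_{BV[0,1]} ≤ 2 ‖f‖_{BV[0,1]}`; in particular
`f ↦ f ∘ h` is a Banach algebra isomorphism of `BV[0,1]` onto itself, even though
`h` is a (non-continuous) bijection of `[0,1]`, not a homeomorphism. -/
theorem folding_map_BV_iso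
    (h : ℝ → ℝ) (hdef : ∀ x, h x = if x ≤ 1 / 2 then 1 / 2 - x else x)
    (f : ℝ → ℂ) :
    Set.BijOn h (Icc 0 1) (Icc 0 1) ∧
    (∀ x ∈ Icc (0 : ℝ) 1, h (h x) = x) ∧
    ¬ ContinuousOn h (Icc 0 1) ∧
    eVariationOn (f ∘ h) (Icc 0 1) ≤ 2 * eVariationOn f (Icc 0 1) ∧
    (1 / 2 : ℝ≥0∞) * bvNormUnit f ≤ bvNormUnit (f ∘ h) ∧
    bvNormUnit (f ∘ h) ≤ 2 * bvNormUnit f := by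
  have hmaps : MapsTo h (Icc 0 1) (Icc 0 1) := by
    intro x hx
    rw [mem_Icc] at hx ⊢
    grind
  have hinv : ∀ x ∈ Icc (0 : ℝ) 1, h (h x) = x := by
    intro x hx
    rw [mem_Icc] at hx
    grind
  have hanti : AntitoneOn h (Icc 0 (1 / 2)) := by
    intro x hx y hy hxy
    rw [mem_Icc] at hx hy
    grind
  have hmono : MonotoneOn h (Icc (1 / 2) 1) := by
    intro x hx y hy hxy
    rw [mem_Icc] at hx hy
    grind
  have hvar (g : ℝ → ℂ) : eVariationOn (g ∘ h) (Icc 0 1) ≤ 2 * eVariationOn g (Icc 0 1) :=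
    eVariationOn_comp_le_two_mul g (by norm_num) (by norm_num) hanti hmono hmaps
  refine ⟨InvOn.bijOn ⟨hinv, hinv⟩ hmaps hmaps, hinv, fun hcont => ?_, hvar f, ?_,
    bvNormUnit_comp_le hmaps (hvar f)⟩
  · obtain ⟨x, hx, hhx⟩ : (1 / 4 : ℝ) ∈ h '' Icc (1 / 2) 1 :=
      intermediate_value_Icc (by norm_num)
        (hcont.mono (Icc_subset_Icc_left (by norm_num))) (by
          rw [hdef, hdef]
          norm_num)
    rw [mem_Icc] at hx
    rw [hdef] at hhx
    split_ifs at hhx <;> linarith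
  · rw [one_div, ← ENNReal.div_eq_inv_mul]
    refine ENNReal.div_le_of_le_mul' ?_
    calc bvNormUnit f = bvNormUnit ((f ∘ h) ∘ h) :=
          bvNormUnit_congr fun x hx => (congrArg f (hinv x hx)).symm
      _ ≤ 2 * bvNormUnit (f ∘ h) := bvNormUnit_comp_le hmaps (hvar (f ∘ h))
end
end

section
/- Let σ₁ = {0} ∪ {1/n : n ≥ 1} ∪ {−1/n : n ≥ 1} and σ₂ = {0} ∪ {1/n : n ≥ 1}, and define h : σ₁ → σ₂ by h(0) = 0, h(−1/n) = 1/(2n−1) and h(1/n) = 1/(2n). Then h is a homeomorphism of σ₁ onto σ₂, and the characteristic function f of the set of positive elements of σ₁ has finite variation on σ₁, but f ∘ h⁻¹ has infinite variation on σ₂. Hence a homeomorphism h need not induce a map f ↦ f ∘ h⁻¹ carrying functions of bounded variation to functions of bounded variation. -/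
open scoped ENNReal
open Set

noncomputable section

lemma eVariationOn_eq_top_of_alternating {E : Type*} [PseudoEMetricSpace E] {g : ℝ → E}
    {s : Set ℝ} {φ : ℕ → ℝ} (hφ : Antitone φ) (hs : ∀ n, φ n ∈ s)
    (h1 : ∀ n, edist (g (φ (n + 1))) (g (φ n)) = 1) : eVariationOn g s = ⊤ := by
  refine ENNReal.eq_top_of_forall_nnreal_le fun r => ?_
  obtain ⟨n, hn⟩ := exists_nat_ge r
  calc (r : ℝ≥0∞) ≤ n := by exact_mod_cast hn
    _ = ∑ i ∈ Finset.range n, edist ((g ∘ φ) (id (i + 1))) ((g ∘ φ) (id i)) := by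
      simp [h1]
    _ ≤ eVariationOn (g ∘ φ) univ := eVariationOn.sum_le monotone_id fun _ => mem_univ _
    _ ≤ eVariationOn g s :=
      eVariationOn.comp_le_of_antitoneOn g φ (hφ.antitoneOn _) fun n _ => hs n

lemma eVariationOn_indicator_pos_lt_top {s : Set ℝ} {a b : ℝ} (ha : IsLeast s a)
    (hb : IsGreatest s b) :
    eVariationOn (fun x : ℝ => if 0 < x then (1 : ℂ) else 0) s < ⊤ := by
  have hm : MonotoneOn (fun x : ℝ => if 0 < x then (1 : ℝ) else 0) s := by
    intro x _ y _ hxy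
    dsimp only
    split_ifs <;> linarith
  have hs : s ∩ Icc a b = s := inter_eq_left.2 fun x hx => ⟨ha.2 hx, hb.2 hx⟩
  have hv := hm.eVariationOn_eq ha.1 hb.1
  rw [hs] at hv
  have hc := (Complex.isometry_ofReal.lipschitz.lipschitzOnWith (s := univ)).comp_eVariationOn_le
    (g := fun x : ℝ => if 0 < x then (1 : ℝ) else 0) (s := s) (fun _ _ => mem_univ _)
  have he : (fun x : ℝ => if 0 < x then (1 : ℂ) else 0) =
      Complex.ofReal ∘ fun x : ℝ => if 0 < x then (1 : ℝ) else 0 := by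
    ext x
    simp only [Function.comp]
    split_ifs <;> simp
  rw [he]
  refine hc.trans_lt ?_
  rw [ENNReal.coe_one, one_mul]
  exact hv.le.trans_lt ENNReal.ofReal_lt_top

lemma isCompact_insert_zero_unit_fractions :
    IsCompact (insert 0 {x : ℝ | ∃ n : ℕ, 0 < n ∧ x = 1 / (n : ℝ)}) := by
  convert (tendsto_one_div_add_atTop_nhds_zero_nat (𝕜 := ℝ)).isCompact_insert_range using 2
  ext x
  constructor
  · rintro ⟨n, hn, rfl⟩
    refine ⟨n - 1, ?_⟩
    dsimp only
    rw [← Nat.cast_add_one, Nat.sub_add_cancel hn]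
  · rintro ⟨n, rfl⟩
    exact ⟨n + 1, n.succ_pos, by push_cast; rfl⟩

lemma isCompact_insert_zero_signed_unit_fractions :
    IsCompact (insert 0 {x : ℝ | ∃ n : ℕ, 0 < n ∧ (x = 1 / (n : ℝ) ∨ x = -(1 / (n : ℝ)))}) := by
  convert isCompact_insert_zero_unit_fractions.union isCompact_insert_zero_unit_fractions.neg
    using 1
  ext x
  simp only [mem_insert_iff, mem_ofPred_eq, mem_union, Set.mem_neg, neg_eq_iff_eq_neg]
  grind

/-- Example 3.4 of the paper.  Let
`σ₁ = {0} ∪ {1/n : n ≥ 1} ∪ {−1/n : n ≥ 1}` and `σ₂ = {0} ∪ {1/n : n ≥ 1}`, and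
let `h : σ₁ → σ₂` be given by `h(0) = 0`, `h(−1/n) = 1/(2n−1)`, `h(1/n) = 1/(2n)`.
Then `h` is a homeomorphism of `σ₁` onto `σ₂`, and the characteristic function `f`
of the set of positive elements of `σ₁` has finite (classical) variation on `σ₁`,
but `f ∘ h⁻¹` has infinite variation on `σ₂`.  Hence a homeomorphism need not
carry functions of bounded variation to functions of bounded variation. -/
theorem homeomorphism_not_preserving_BV
    (σ₁ σ₂ : Set ℝ)
    (hσ₁ : σ₁ = insert 0 {x : ℝ | ∃ n : ℕ, 0 < n ∧ (x = 1 / (n : ℝ) ∨ x = -(1 / (n : ℝ)))})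
    (hσ₂ : σ₂ = insert 0 {x : ℝ | ∃ n : ℕ, 0 < n ∧ x = 1 / (n : ℝ)})
    (h : ℝ → ℝ) (h0 : h 0 = 0)
    (hneg : ∀ n : ℕ, 0 < n → h (-(1 / (n : ℝ))) = 1 / (2 * (n : ℝ) - 1))
    (hpos : ∀ n : ℕ, 0 < n → h (1 / (n : ℝ)) = 1 / (2 * (n : ℝ)))
    (f : ℝ → ℂ) (hf : ∀ x, f x = if 0 < x then 1 else 0) :
    (∃ e : ↥σ₁ ≃ₜ ↥σ₂, ∀ x : ↥σ₁, (e x : ℝ) = h (x : ℝ)) ∧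
    eVariationOn f σ₁ < ⊤ ∧
    (∀ g : ℝ → ℂ, (∀ x ∈ σ₁, g (h x) = f x) → eVariationOn g σ₂ = ⊤) := by
  have hpos_iff (n : ℕ) (hn : 0 < n) : (0 : ℝ) < 1 / n := by positivity
  have hle_one (n : ℕ) (hn : 0 < n) : (1 : ℝ) / n ≤ 1 := by
    rw [div_le_one (by positivity)]
    exact_mod_cast hn
  have hmem_pos (n : ℕ) (hn : 0 < n) : (1 / n : ℝ) ∈ σ₁ := by
    rw [hσ₁]; exact Or.inr ⟨n, hn, Or.inl rfl⟩
  have hmem_neg (n : ℕ) (hn : 0 < n) : (-(1 / n) : ℝ) ∈ σ₁ := by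
    rw [hσ₁]; exact Or.inr ⟨n, hn, Or.inr rfl⟩
  have hmem₂ (n : ℕ) (hn : 0 < n) : (1 / n : ℝ) ∈ σ₂ := by
    rw [hσ₂]; exact Or.inr ⟨n, hn, rfl⟩
  have hcases : ∀ x ∈ σ₁, x = 0 ∨ ∃ n : ℕ, 0 < n ∧ (x = 1 / (n : ℝ) ∨ x = -(1 / (n : ℝ))) := by
    intro x hx
    rwa [hσ₁] at hx
  have hcases_succ : ∀ x ∈ σ₁, x = 0 ∨
      ∃ n : ℕ, x = 1 / ((n + 1 : ℕ) : ℝ) ∨ x = -(1 / ((n + 1 : ℕ) : ℝ)) := by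
    intro x hx
    refine (hcases x hx).imp_right ?_
    rintro ⟨n, hn, hx⟩
    exact ⟨n - 1, by rwa [Nat.sub_add_cancel hn]⟩
  have hodd (n : ℕ) : h (-(1 / ((n + 1 : ℕ) : ℝ))) = 1 / ((2 * n + 1 : ℕ) : ℝ) := by
    rw [hneg _ n.succ_pos]
    push_cast
    ring
  have heven (n : ℕ) : h (1 / ((n + 1 : ℕ) : ℝ)) = 1 / ((2 * n + 1 + 1 : ℕ) : ℝ) := by
    rw [hpos _ n.succ_pos]
    push_cast
    ring
  have hinj : InjOn h σ₁ := by
    have key (a b : ℕ) (hab : 1 / (a : ℝ) = 1 / (b : ℝ)) : a = b := by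
      simpa using hab
    have hne (a : ℕ) : 1 / ((a + 1 : ℕ) : ℝ) ≠ 0 := (hpos_iff _ a.succ_pos).ne'
    intro x hx y hy hxy
    rcases hcases_succ x hx with rfl | ⟨n, rfl | rfl⟩ <;>
    rcases hcases_succ y hy with rfl | ⟨m, rfl | rfl⟩ <;>
    simp only [h0, hodd, heven] at hxy <;>
    first
    | rfl
    | exact absurd hxy (hne _)
    | exact absurd hxy.symm (hne _)
    | (have := key _ _ hxy
       first
       | omega
       | (obtain rfl : n = m := by omega
          rfl))
  have hsurj : h '' σ₁ = σ₂ := by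
    apply Subset.antisymm
    · rintro _ ⟨x, hx, rfl⟩
      rcases hcases_succ x hx with rfl | ⟨n, rfl | rfl⟩
      · rw [h0, hσ₂]; exact mem_insert _ _
      · rw [heven]; exact hmem₂ _ (Nat.succ_pos _)
      · rw [hodd]; exact hmem₂ _ (Nat.succ_pos _)
    · rw [hσ₂]
      rintro x (rfl | ⟨n, hn, rfl⟩)
      · exact ⟨0, by rw [hσ₁]; exact mem_insert _ _, h0⟩
      · obtain ⟨k, rfl | rfl⟩ : ∃ k, n = 2 * k + 1 ∨ n = 2 * k + 1 + 1 :=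
          ⟨(n - 1) / 2, by omega⟩
        · exact ⟨_, hmem_neg _ k.succ_pos, hodd k⟩
        · exact ⟨_, hmem_pos _ k.succ_pos, heven k⟩
  have hcont : ContinuousOn h σ₁ := by
    have hc : ContinuousOn (fun x : ℝ => max x 0 / 2 + max (-x) 0 / (2 - max (-x) 0)) σ₁ := by
      refine ContinuousOn.add (by fun_prop) (ContinuousOn.div (by fun_prop) (by fun_prop) ?_)
      intro x hx
      have : max (-x) 0 ≤ 1 := by
        rcases hcases x hx with rfl | ⟨n, hn, rfl | rfl⟩
        · simp
        · exact max_le (by linarith [hpos_iff n hn]) zero_le_one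
        · exact max_le (by linarith [hle_one n hn]) zero_le_one
      linarith
    refine hc.congr fun x hx => ?_
    rcases hcases x hx with rfl | ⟨n, hn, rfl | rfl⟩
    · simp [h0]
    · have := hpos_iff n hn
      dsimp only
      rw [hpos n hn, max_eq_left this.le, max_eq_right (by linarith)]
      ring
    · have := hpos_iff n hn
      have h1 : (1 : ℝ) ≤ n := by exact_mod_cast hn
      have h2 : (2 * n - 1 : ℝ) ≠ 0 := by linarith
      dsimp only
      rw [hneg n hn, max_eq_right (by linarith), neg_neg, max_eq_left this.le]
      have h3 : (2 - 1 / n : ℝ) = (2 * n - 1) / n := by field_simp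
      rw [h3]
      field_simp
      ring
  refine ⟨?_, ?_, ?_⟩
  · have hK : CompactSpace σ₁ := isCompact_iff_compactSpace.1 <| by
      rw [hσ₁]; exact isCompact_insert_zero_signed_unit_fractions
    have hbij : BijOn h σ₁ σ₂ := ⟨hsurj ▸ mapsTo_image h σ₁, hinj, hsurj.ge⟩
    have hce : Continuous (hbij.equiv h) :=
      Continuous.subtype_mk (continuousOn_iff_continuous_domRestrict.1 hcont) _
    exact ⟨hce.homeoOfEquivCompactToT2, fun _ => rfl⟩
  · obtain rfl : f = fun x : ℝ => if 0 < x then (1 : ℂ) else 0 := funext hf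
    refine eVariationOn_indicator_pos_lt_top (a := -1) (b := 1)
      ⟨by simpa using hmem_neg 1 one_pos, fun x hx => ?_⟩
      ⟨by simpa using hmem_pos 1 one_pos, fun x hx => ?_⟩
    all_goals
      rcases hcases x hx with rfl | ⟨n, hn, rfl | rfl⟩
      · norm_num
      all_goals linarith [hpos_iff n hn, hle_one n hn]
  · intro g hg
    have hg_odd (k : ℕ) : g (1 / ((2 * k + 1 : ℕ) : ℝ)) = 0 := by
      rw [← hodd, hg _ (hmem_neg _ k.succ_pos), hf, if_neg]
      linarith [hpos_iff _ k.succ_pos]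
    have hg_even (k : ℕ) : g (1 / ((2 * k + 1 + 1 : ℕ) : ℝ)) = 1 := by
      rw [← heven, hg _ (hmem_pos _ k.succ_pos), hf, if_pos (hpos_iff _ k.succ_pos)]
    refine eVariationOn_eq_top_of_alternating (φ := fun n : ℕ => 1 / ((n + 1 : ℕ) : ℝ))
      (fun m n hmn => ?_) (fun n => hmem₂ _ n.succ_pos) fun n => ?_
    · exact one_div_le_one_div_of_le (by positivity) (by exact_mod_cast Nat.succ_le_succ hmn)
    · obtain ⟨k, rfl | rfl⟩ : ∃ k, n = 2 * k ∨ n = 2 * k + 1 := ⟨n / 2, by omega⟩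
      · rw [hg_even, hg_odd]
        simp [edist_dist]
      · rw [hg_even, show 2 * k + 1 + 1 + 1 = 2 * (k + 1) + 1 by ring, hg_odd]
        simp [edist_dist]
end
end
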